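/- Let μ be a matching in a finite simple graph G and let D ⊆ E(G) be a set of edges such that (i) every vertex of G is incident to at most one edge of D \ μ, and (ii) every vertex incident to an edge of D \ μ is either unmatched by μ or its matching edge in μ belongs to D. Then the symmetric difference μ△D is a matching in G. -/

import Mathlib

namespace AlmostStableMarriage

variable {V : Type*}

/-- `M` is a matching in `G`: a set of edges of `G` that are pairwise vertex-disjoint. -/
def IsMatching (G : SimpleGraph V) (M : Set (Sym2 V)) : Prop :=
  M ⊆ G.edgeSet ∧ ∀ e ∈ M, ∀ f ∈ M, e ≠ f → ∀ v : V, v ∈ e → v ∉ f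

/-- Let `μ` be a matching of `G` and `D ⊆ E(G)` a set of edges such
that (i) every vertex is incident to at most one edge of `D \ μ`, and (ii) every vertex
incident to an edge of `D \ μ` is unmatched by `μ` or its matching edge belongs to `D`.
Then `μ △ D` is a matching of `G`. -/
theorem symmDiff_isMatching [Fintype V]
    (G : SimpleGraph V) (μ : Set (Sym2 V)) (hμ : IsMatching G μ)
    (D : Set (Sym2 V)) (hD : D ⊆ G.edgeSet)
    (h1 : ∀ v : V, ∀ e ∈ D \ μ, ∀ f ∈ D \ μ, v ∈ e → v ∈ f → e = f)
    (h2 : ∀ v : V, (∃ e ∈ D \ μ, v ∈ e) → ∀ e ∈ μ, v ∈ e → e ∈ D) :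
    IsMatching G (symmDiff μ D) := by
  refine ⟨?_, ?_⟩
  · rintro e (⟨he, _⟩ | ⟨he, _⟩)
    · exact hμ.1 he
    · exact hD he
  · rintro e (⟨he, he'⟩ | ⟨he, he'⟩) f (⟨hf, hf'⟩ | ⟨hf, hf'⟩) hne v hve hvf
    · exact hμ.2 e he f hf hne v hve hvf
    · exact he' (h2 v ⟨f, ⟨hf, hf'⟩, hvf⟩ e he hve)
    · exact hf' (h2 v ⟨e, ⟨he, he'⟩, hve⟩ f hf hvf)
    · exact hne (h1 v e ⟨he, he'⟩ f ⟨hf, hf'⟩ hve hvf)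

end AlmostStableMarriage
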